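/- arXiv:1710.05904 — 2 statements merged into one kernel-verified Lean document; each statement's English description precedes it below -/
import Mathlib

section
/- Let G = ⟨x₁,…,x_k | r₁,…,r_l⟩ be a finitely presented group with H_1(G,ℤ) = 0 and H_2(G,ℤ) = 0, and suppose d(G^N) ≤ k for some integer N. If m is a positive integer with m ≤ N/2, then G^m has a presentation with k generators and at most (k² + 2k)·(log₂ m + 1) + l + k relators; equivalently, with at most n(k² + 2k) + l + k relators where n is the least integer with m ≤ 2ⁿ. -/
/-- `Γ` has a presentation with `k` generators and at most `l` relators:
a surjection from the free group of rank `k` whose kernel is the normal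
closure of a set of at most `l` elements. -/
def HasPresentationCard (Γ : Type*) [Group Γ] (k l : ℕ) : Prop :=
  ∃ φ : FreeGroup (Fin k) →* Γ, Function.Surjective φ ∧
    ∃ R : Set (FreeGroup (Fin k)), R.Finite ∧ R.ncard ≤ l ∧
      φ.ker = Subgroup.normalClosure R

/-- `Γ` is finitely presented. -/
def FinitelyPresented (Γ : Type*) [Group Γ] : Prop :=
  ∃ k l, HasPresentationCard Γ k l

/-- `d(Γ)`: the minimal cardinality of a (finite) generating set of `Γ`. -/
noncomputable def dGen (Γ : Type*) [Group Γ] : ℕ :=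
  sInf {d | ∃ S : Set Γ, S.Finite ∧ S.ncard = d ∧ Subgroup.closure S = ⊤}

/-- `ρ(Γ)`: the minimal number of relators among all finite presentations of `Γ`. -/
noncomputable def rho (Γ : Type*) [Group Γ] : ℕ :=
  sInf {l | ∃ k, HasPresentationCard Γ k l}

/-- The kernel `R` of the canonical presentation of `G` by the free group on
the underlying set of `G`. -/
abbrev freeKernel (G : Type*) [Group G] : Subgroup (FreeGroup G) :=
  (FreeGroup.lift (id : G → G)).ker

/-- `H₂(G,ℤ)`, presented via Hopf's formula `H₂(G,ℤ) ≅ (R ⊓ [F,F]) / [F,R]`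
applied to the canonical free presentation `1 → R → F → G → 1` with `F` the
free group on the underlying set of `G`. -/
abbrev H2 (G : Type*) [Group G] : Type _ :=
  ↥(freeKernel G ⊓ commutator (FreeGroup G)) ⧸
    (⁅(⊤ : Subgroup (FreeGroup G)), freeKernel G⁆.subgroupOf
      (freeKernel G ⊓ commutator (FreeGroup G)))

section Helpers
open scoped commutatorElement

/-- Every central extension of `A` meets the commutator subgroup trivially. -/
def SPC (A : Type) [Group A] : Prop :=
  ∀ (E : Type) [Group E] (φ : E →* A), Function.Surjective φ → φ.ker ≤ Subgroup.center E →
    ∀ c ∈ commutator E, φ c = 1 → c = 1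

theorem comm_central {E : Type*} [Group E] (a b y z : E) (hy : y ∈ Subgroup.center E)
    (hz : z ∈ Subgroup.center E) : ⁅a * y, b * z⁆ = ⁅a, b⁆ := by
  rw [Subgroup.mem_center_iff] at hy hz
  simp only [commutatorElement_def, mul_inv_rev]
  calc a * y * (b * z) * (y⁻¹ * a⁻¹) * (z⁻¹ * b⁻¹)
      = a * (y * b) * (z * y⁻¹ * a⁻¹) * z⁻¹ * b⁻¹ := by group
    _ = a * (b * y) * (y⁻¹ * a⁻¹ * z) * z⁻¹ * b⁻¹ := by
        rw [← hy b, hz (y⁻¹ * a⁻¹), mul_assoc z]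
    _ = a * b * a⁻¹ * b⁻¹ := by group

theorem SPC.of_H2 {G : Type} [Group G] (h : Subsingleton (H2 G)) : SPC G := by
  intro E _ φ hφ hc c hcE hc1
  choose s hs using hφ
  let f : FreeGroup G →* E := FreeGroup.lift s
  have hf : ∀ w, φ (f w) = FreeGroup.lift (id : G → G) w := by
    intro w
    have : φ.comp f = FreeGroup.lift (id : G → G) := by
      apply FreeGroup.ext_hom
      intro a
      simp [f, hs]
    exact DFunLike.congr_fun this w
  have key : commutator E ≤ (commutator (FreeGroup G)).map f := by
    rw [commutator_def, Subgroup.commutator_le]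
    intro g₁ _ g₂ _
    have hz : ∀ g : E, (f (FreeGroup.of (φ g)))⁻¹ * g ∈ Subgroup.center E := by
      intro g
      apply hc
      rw [MonoidHom.mem_ker, map_mul, map_inv, hf]
      simp
    have := comm_central (f (FreeGroup.of (φ g₁))) (f (FreeGroup.of (φ g₂))) _ _ (hz g₁) (hz g₂)
    rw [mul_inv_cancel_left, mul_inv_cancel_left, ← map_commutatorElement] at this
    rw [this]
    exact ⟨_, Subgroup.commutator_mem_commutator (Subgroup.mem_top _) (Subgroup.mem_top _), rfl⟩
  obtain ⟨w, hw, rfl⟩ := key hcE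
  have hwk : w ∈ freeKernel G := by
    rw [MonoidHom.mem_ker, ← hf, hc1]
  have hw2 : w ∈ ⁅(⊤ : Subgroup (FreeGroup G)), freeKernel G⁆ := by
    have h1 := (QuotientGroup.eq_one_iff (N := (⁅(⊤ : Subgroup (FreeGroup G)), freeKernel G⁆.subgroupOf
      (freeKernel G ⊓ commutator (FreeGroup G))))
        (⟨w, hwk, hw⟩ : ↥(freeKernel G ⊓ commutator (FreeGroup G)))).1 (h.elim _ _)
    exact h1
  have h3 : ⁅(⊤ : Subgroup (FreeGroup G)), freeKernel G⁆ ≤ f.ker := by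
    rw [Subgroup.commutator_le]
    intro g _ k hk
    rw [MonoidHom.mem_ker, map_commutatorElement, commutatorElement_eq_one_iff_mul_comm]
    have : f k ∈ Subgroup.center E := hc (by rw [MonoidHom.mem_ker, hf]; exact hk)
    exact Subgroup.mem_center_iff.1 this _
  exact h3 hw2

theorem SPC.congr {A B : Type} [Group A] [Group B] (e : A ≃* B) (h : SPC A) : SPC B := by
  intro E _ φ hφ hc c hcE hc1
  refine h E (e.symm.toMonoidHom.comp φ) (e.symm.surjective.comp hφ) ?_ c hcE (by simp [hc1])
  intro x hx
  apply hc
  rw [MonoidHom.mem_ker] at hx ⊢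
  simpa using hx

theorem central_commute_aux {E A : Type} [Group E] [Group A] (hA : commutator A = ⊤)
    (p : E →* A) (P Z Q : Subgroup E) (hZ : Z ≤ Subgroup.center E)
    (hp : ∀ a, ∃ e ∈ P, p e = a) (hker : ∀ e ∈ P, p e = 1 → e ∈ Z)
    (hPQ : ∀ a ∈ P, ∀ b ∈ Q, ⁅a, b⁆ ∈ Z) : ∀ a ∈ P, ∀ b ∈ Q, a * b = b * a := by
  intro a ha b hb
  have h1 : ⁅P, P⁆ ≤ Subgroup.centralizer {b} := by
    rw [Subgroup.commutator_le]
    intro x hx y hy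
    rw [Subgroup.mem_centralizer_singleton_iff]
    have hxz := Subgroup.mem_center_iff.1 (hZ (hPQ x hx b hb))
    have hyz := Subgroup.mem_center_iff.1 (hZ (hPQ y hy b hb))
    set u := ⁅x, b⁆ with hu
    set v := ⁅y, b⁆ with hv
    have e1 : x * b = u * b * x := by rw [hu, commutatorElement_def]; group
    have e2 : y * b = v * b * y := by rw [hv, commutatorElement_def]; group
    have e3 : (x * y) * b = b * (u * v) * (x * y) := by
      calc (x * y) * b = x * (y * b) := by group
        _ = (x * v) * b * y := by rw [e2]; group
        _ = v * (x * b) * y := by rw [hyz x]; group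
        _ = v * (u * b) * x * y := by rw [e1]; group
        _ = v * (b * u) * x * y := by rw [← hxz b]
        _ = (v * (b * u)) * x * y := by group
        _ = _ := by rw [← hyz (b * u)]; group
    have e4 : (y * x) * b = b * (u * v) * (y * x) := by
      calc (y * x) * b = y * (x * b) := by group
        _ = (y * u) * b * x := by rw [e1]; group
        _ = u * (y * b) * x := by rw [hxz y]; group
        _ = u * v * b * y * x := by rw [e2]; group
        _ = u * (v * b) * y * x := by group
        _ = (u * b) * v * y * x := by rw [← hyz b]; group
        _ = _ := by rw [← hxz b]; group
    have e5 : ⁅x, y⁆ = (x * y) * (y * x)⁻¹ := by rw [commutatorElement_def]; group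
    have e6 : (y * x)⁻¹ * (b * (u * v)) = b * (y * x)⁻¹ := by
      rw [inv_mul_eq_iff_eq_mul, ← mul_assoc (y * x) b, e4]; group
    have huv : ∀ g, g * (u * v) = (u * v) * g := by
      intro g; rw [← mul_assoc, hxz, mul_assoc, hyz, mul_assoc]
    rw [e5]
    have e7 : (y * x)⁻¹ * b = b * (y * x)⁻¹ * (u * v)⁻¹ := by
      rw [← e6]; group
    have huv' : ∀ g, g * (u * v)⁻¹ = (u * v)⁻¹ * g := by
      intro g; rw [mul_inv_eq_iff_eq_mul, mul_assoc, huv, inv_mul_cancel_left]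
    calc (x * y) * (y * x)⁻¹ * b = (x * y) * ((y * x)⁻¹ * b) := by group
      _ = ((x * y) * b) * ((y * x)⁻¹ * (u * v)⁻¹) := by rw [e7]; group
      _ = b * (u * v) * (x * y) * ((u * v)⁻¹ * (y * x)⁻¹) := by rw [e3, huv']
      _ = b * (u * v) * ((x * y) * (u * v)⁻¹) * (y * x)⁻¹ := by group
      _ = b * ((x * y) * (y * x)⁻¹) := by rw [huv']; group
  have hmap : P.map p = ⊤ := by
    rw [eq_top_iff]
    intro a _
    obtain ⟨e, he, rfl⟩ := hp a
    exact ⟨e, he, rfl⟩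
  have h2 : (⁅P, P⁆ : Subgroup E).map p = ⊤ := by
    rw [Subgroup.map_commutator, hmap, ← commutator_def, hA]
  obtain ⟨u, hu, hua⟩ : p a ∈ (⁅P, P⁆ : Subgroup E).map p := by rw [h2]; trivial
  have huP : u ∈ P := Subgroup.commutator_le_self P hu
  have hz : u⁻¹ * a ∈ Z := hker _ (P.mul_mem (P.inv_mem huP) ha) (by rw [map_mul, map_inv, hua]; simp)
  have hz' := Subgroup.mem_center_iff.1 (hZ hz) b
  have hub := Subgroup.mem_centralizer_singleton_iff.1 (h1 hu)
  calc a * b = u * ((u⁻¹ * a) * b) := by group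
    _ = (u * b) * (u⁻¹ * a) := by rw [← hz']; group
    _ = b * a := by rw [hub]; group

theorem SPC.prod {A B : Type} [Group A] [Group B] (hA : SPC A) (hB : SPC B)
    (pA : commutator A = ⊤) : SPC (A × B) := by
  intro E _ φ hφ hc c hcE hc1
  let p : E →* A := (MonoidHom.fst A B).comp φ
  let q : E →* B := (MonoidHom.snd A B).comp φ
  have hpe : ∀ e, p e = (φ e).1 := fun _ => rfl
  have hqe : ∀ e, q e = (φ e).2 := fun _ => rfl
  have hk : ∀ e, p e = 1 → q e = 1 → e ∈ φ.ker := fun e h1 h2 => by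
    rw [MonoidHom.mem_ker]; exact Prod.ext h1 h2
  have hp : ∀ a, ∃ e ∈ q.ker, p e = a := fun a => by
    obtain ⟨e, he⟩ := hφ (a, 1)
    exact ⟨e, by rw [MonoidHom.mem_ker, hqe, he], by rw [hpe, he]⟩
  have hq : ∀ b, ∃ e ∈ p.ker, q e = b := fun b => by
    obtain ⟨e, he⟩ := hφ (1, b)
    exact ⟨e, by rw [MonoidHom.mem_ker, hpe, he], by rw [hqe, he]⟩
  have comm : ∀ a ∈ q.ker, ∀ b ∈ p.ker, a * b = b * a := by
    refine central_commute_aux pA p q.ker φ.ker p.ker hc hp (fun e he h => hk e h he) ?_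
    intro a ha b hb
    rw [MonoidHom.mem_ker] at ha hb
    apply hk <;> rw [map_commutatorElement] <;> simp [ha, hb]
  have key : commutator E ≤ ⁅q.ker, q.ker⁆ ⊔ ⁅p.ker, p.ker⁆ := by
    rw [commutator_def, Subgroup.commutator_le]
    intro g₁ _ g₂ _
    have dec : ∀ g : E, ∃ a ∈ q.ker, ∃ b ∈ p.ker, g = a * b := fun g => by
      obtain ⟨a, ha, hag⟩ := hp (p g)
      exact ⟨a, ha, a⁻¹ * g, by rw [MonoidHom.mem_ker, map_mul, map_inv, hag]; simp, by group⟩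
    obtain ⟨a, ha, b, hb, rfl⟩ := dec g₁
    obtain ⟨a', ha', b', hb', rfl⟩ := dec g₂
    have : ⁅a * b, a' * b'⁆ = ⁅a, a'⁆ * ⁅b, b'⁆ := by
      simp only [commutatorElement_def, mul_inv_rev]
      have c1 := comm a' ha' b hb
      have c2 := comm a⁻¹ (inv_mem ha) (b * b' * b⁻¹) (mul_mem (mul_mem hb hb') (inv_mem hb))
      have c3 := comm a'⁻¹ (inv_mem ha') (b * b' * b⁻¹ * b'⁻¹)
        (mul_mem (mul_mem (mul_mem hb hb') (inv_mem hb)) (inv_mem hb'))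
      calc a * b * (a' * b') * (b⁻¹ * a⁻¹) * (b'⁻¹ * a'⁻¹)
          = a * (b * a') * b' * b⁻¹ * a⁻¹ * b'⁻¹ * a'⁻¹ := by group
        _ = a * a' * ((b * b' * b⁻¹) * a⁻¹) * b'⁻¹ * a'⁻¹ := by rw [← c1]; group
        _ = a * a' * a⁻¹ * ((b * b' * b⁻¹ * b'⁻¹) * a'⁻¹) := by rw [← c2]; group
        _ = _ := by rw [← c3]; group
    rw [this]
    exact mul_mem (Subgroup.mem_sup_left (Subgroup.commutator_mem_commutator ha ha'))
      (Subgroup.mem_sup_right (Subgroup.commutator_mem_commutator hb hb'))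
  obtain ⟨u, hu, v, hv, rfl⟩ := Subgroup.mem_sup_of_normal_left.1 (key hcE)
  have huq : q u = 1 := Subgroup.commutator_le_self _ hu
  have hvp : p v = 1 := Subgroup.commutator_le_self _ hv
  have hup : p u = 1 := by
    have : p (u * v) = 1 := by rw [hpe, hc1]; rfl
    rwa [map_mul, hvp, mul_one] at this
  have hvq : q v = 1 := by
    have : q (u * v) = 1 := by rw [hqe, hc1]; rfl
    rwa [map_mul, huq, one_mul] at this
  have hu1 : u = 1 := by
    rw [← Subgroup.map_subtype_commutator] at hu
    obtain ⟨w, hw, rfl⟩ := hu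
    have := hA q.ker (p.comp q.ker.subtype) (fun a => by
      obtain ⟨e, he, h⟩ := hp a
      exact ⟨⟨e, he⟩, h⟩) (fun x hx => by
        rw [Subgroup.mem_center_iff]
        intro g
        exact Subtype.ext (Subgroup.mem_center_iff.1 (hc (hk _ hx x.2)) g)) w hw hup
    rw [this]; rfl
  have hv1 : v = 1 := by
    rw [← Subgroup.map_subtype_commutator] at hv
    obtain ⟨w, hw, rfl⟩ := hv
    have := hB p.ker (q.comp p.ker.subtype) (fun a => by
      obtain ⟨e, he, h⟩ := hq a
      exact ⟨⟨e, he⟩, h⟩) (fun x hx => by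
        rw [Subgroup.mem_center_iff]
        intro g
        exact Subtype.ext (Subgroup.mem_center_iff.1 (hc (hk _ x.2 hx)) g)) w hw hvq
    rw [this]; rfl
  rw [hu1, hv1, mul_one]

theorem SPC.hopf {A : Type} [Group A] (h : SPC A) {F : Type} [Group F] (φ : F →* A)
    (hφ : Function.Surjective φ) (c : F) (hc : c ∈ commutator F) (hc1 : φ c = 1) :
    c ∈ ⁅(⊤ : Subgroup F), φ.ker⁆ := by
  have hle : ⁅(⊤ : Subgroup F), φ.ker⁆ ≤ φ.ker := Subgroup.commutator_le_right _ _
  have := h (F ⧸ ⁅(⊤ : Subgroup F), φ.ker⁆) (QuotientGroup.lift _ φ hle)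
    (fun a => by
      obtain ⟨x, rfl⟩ := hφ a
      exact ⟨QuotientGroup.mk x, rfl⟩)
    (fun x hx => by
      obtain ⟨x, rfl⟩ := QuotientGroup.mk_surjective x
      rw [Subgroup.mem_center_iff]
      intro g
      obtain ⟨g, rfl⟩ := QuotientGroup.mk_surjective g
      have hx' : x ∈ φ.ker := hx
      rw [← commutatorElement_eq_one_iff_mul_comm]
      exact (QuotientGroup.eq_one_iff (N := ⁅(⊤ : Subgroup F), φ.ker⁆) ⁅g, x⁆).2
        (Subgroup.commutator_mem_commutator (Subgroup.mem_top _) hx'))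
    (QuotientGroup.mk c) (by
      have : QuotientGroup.mk' ⁅(⊤ : Subgroup F), φ.ker⁆ c ∈
          (commutator F).map (QuotientGroup.mk' ⁅(⊤ : Subgroup F), φ.ker⁆) := ⟨c, hc, rfl⟩
      rw [commutator_def, Subgroup.map_commutator] at this
      exact Subgroup.commutator_mono le_top le_top this) hc1
  exact (QuotientGroup.eq_one_iff _).1 this

theorem ncard_range_fin {ι β : Type*} [Fintype ι] (f : ι → β) :
    (Set.range f).ncard ≤ Fintype.card ι := by
  rw [← Set.image_univ]
  refine (Set.ncard_image_le Set.finite_univ).trans ?_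
  rw [Set.ncard_univ, Nat.card_eq_fintype_card]

theorem HasPresentationCard.congr {A B : Type*} [Group A] [Group B] (e : A ≃* B) {k l : ℕ}
    (h : HasPresentationCard A k l) : HasPresentationCard B k l := by
  obtain ⟨φ, hφ, R, hR, hRc, hk⟩ := h
  refine ⟨e.toMonoidHom.comp φ, e.surjective.comp hφ, R, hR, hRc, ?_⟩
  rw [← hk]
  ext x
  simp [MonoidHom.mem_ker]

theorem HasPresentationCard.mono {A : Type*} [Group A] {k l l' : ℕ} (hl : l ≤ l')
    (h : HasPresentationCard A k l) : HasPresentationCard A k l' := by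
  obtain ⟨φ, hφ, R, hR, hRc, hk⟩ := h
  exact ⟨φ, hφ, R, hR, hRc.trans hl, hk⟩

theorem change_gens {α Γ : Type*} [Group Γ] {k t : ℕ} (ψ : FreeGroup α →* Γ)
    (hψ : Function.Surjective ψ) (T : Set (FreeGroup α)) (hT : T.Finite) (hTc : T.ncard ≤ t)
    (hker : ψ.ker = Subgroup.normalClosure T) (θ : FreeGroup (Fin k) →* Γ)
    (hθ : Function.Surjective θ) : HasPresentationCard Γ k (t + k) := by
  choose u hu using fun a : α => hθ (ψ (FreeGroup.of a))
  choose v hv using fun i : Fin k => hψ (θ (FreeGroup.of i))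
  let U : FreeGroup α →* FreeGroup (Fin k) := FreeGroup.lift u
  let V : FreeGroup (Fin k) →* FreeGroup α := FreeGroup.lift v
  have hU : ∀ w, θ (U w) = ψ w := by
    intro w
    have : θ.comp U = ψ := FreeGroup.ext_hom _ _ fun a => by simp [U, hu]
    exact DFunLike.congr_fun this w
  have hV : ∀ w, ψ (V w) = θ w := by
    intro w
    have : ψ.comp V = θ := FreeGroup.ext_hom _ _ fun a => by simp [V, hv]
    exact DFunLike.congr_fun this w
  let S : Set (FreeGroup (Fin k)) := Set.range fun i => (FreeGroup.of i)⁻¹ * U (v i)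
  have hTk : ∀ x ∈ T, ψ x = 1 := fun x hx => by
    have : x ∈ ψ.ker := hker ▸ Subgroup.subset_normalClosure hx
    exact this
  refine ⟨θ, hθ, U '' T ∪ S, (hT.image _).union (Set.finite_range _), ?_, le_antisymm ?_ ?_⟩
  · refine (Set.ncard_union_le _ _).trans (add_le_add ((Set.ncard_image_le hT).trans hTc) ?_)
    simpa using ncard_range_fin fun i : Fin k => (FreeGroup.of i)⁻¹ * U (v i)
  · intro w hw
    let M := Subgroup.normalClosure (U '' T ∪ S)
    have h1 : ∀ w, QuotientGroup.mk' M (U (V w)) = QuotientGroup.mk' M w := by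
      intro w
      have : ((QuotientGroup.mk' M).comp U).comp V = QuotientGroup.mk' M := by
        refine FreeGroup.ext_hom _ _ fun i => ?_
        have hi : (FreeGroup.of i)⁻¹ * U (v i) ∈ M :=
          Subgroup.subset_normalClosure (Or.inr ⟨i, rfl⟩)
        have := QuotientGroup.eq.2 hi
        simp only [MonoidHom.comp_apply, V, FreeGroup.lift_apply_of]
        exact this.symm
      exact DFunLike.congr_fun this w
    have h2 : V w ∈ Subgroup.normalClosure T := by
      rw [← hker, MonoidHom.mem_ker, hV]; exact hw
    have h3 : Subgroup.normalClosure T ≤ ((QuotientGroup.mk' M).comp U).ker := by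
      apply Subgroup.normalClosure_le_normal
      intro x hx
      exact (QuotientGroup.eq_one_iff (N := M) (U x)).2
        (Subgroup.subset_normalClosure (Or.inl ⟨x, hx, rfl⟩))
    have h4 : QuotientGroup.mk' M (U (V w)) = 1 := h3 h2
    rw [h1] at h4
    exact (QuotientGroup.eq_one_iff (N := M) w).1 h4
  · apply Subgroup.normalClosure_le_normal
    rintro x (⟨y, hy, rfl⟩ | ⟨i, rfl⟩)
    · simp only [SetLike.mem_coe, MonoidHom.mem_ker]
      rw [hU, hTk y hy]
    · simp only [SetLike.mem_coe, MonoidHom.mem_ker]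
      rw [map_mul, hU, hv, map_inv, inv_mul_cancel]

theorem pres_quot {A B : Type*} [Group A] [Group B] {k L : ℕ}
    (h : HasPresentationCard (A × B) k L) (θ : FreeGroup (Fin k) →* B)
    (hθ : Function.Surjective θ) : HasPresentationCard A k (L + k) := by
  obtain ⟨φ, hφ, R, hR, hRc, hk⟩ := h
  choose g hg using fun i : Fin k => hφ (1, θ (FreeGroup.of i))
  let S : Set (FreeGroup (Fin k)) := Set.range g
  refine ⟨(MonoidHom.fst A B).comp φ, Prod.fst_surjective.comp hφ, R ∪ S,
    hR.union (Set.finite_range _), ?_, le_antisymm ?_ ?_⟩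
  · refine (Set.ncard_union_le _ _).trans (add_le_add hRc ?_)
    simpa using ncard_range_fin g
  · intro w hw
    have hw : (φ w).1 = 1 := hw
    obtain ⟨z, hz⟩ := hθ (φ w).2
    let Gm : FreeGroup (Fin k) →* FreeGroup (Fin k) := FreeGroup.lift g
    have h1 : φ.comp Gm = (MonoidHom.inr A B).comp θ := FreeGroup.ext_hom _ _ fun i => by
      simp [Gm, hg]
    have h2 : φ (Gm z) = φ w := by
      have : φ (Gm z) = (1, θ z) := DFunLike.congr_fun h1 z
      rw [this, hz, ← hw]
    have h3 : w * (Gm z)⁻¹ ∈ Subgroup.normalClosure (R ∪ S) := by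
      apply Subgroup.normalClosure_mono Set.subset_union_left
      rw [← hk, MonoidHom.mem_ker, map_mul, map_inv, h2, mul_inv_cancel]
    have h4 : Gm z ∈ Subgroup.normalClosure (R ∪ S) := by
      have : Gm.range ≤ Subgroup.normalClosure (R ∪ S) := by
        rw [FreeGroup.range_lift_eq_closure, Subgroup.closure_le]
        exact Set.subset_union_right.trans Subgroup.subset_normalClosure
      exact this ⟨z, rfl⟩
    simpa using mul_mem h3 h4
  · apply Subgroup.normalClosure_le_normal
    rintro x (hx | ⟨i, rfl⟩)
    · have : x ∈ φ.ker := hk ▸ Subgroup.subset_normalClosure hx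
      have : φ x = 1 := this
      simp [MonoidHom.mem_ker, this]
    · simp [MonoidHom.mem_ker, hg]

theorem free_commute {α β E : Type*} [Group E] (f : FreeGroup α →* E) (g : FreeGroup β →* E)
    (h : ∀ a b, Commute (f (FreeGroup.of a)) (g (FreeGroup.of b))) (x : FreeGroup α)
    (y : FreeGroup β) : Commute (f x) (g y) := by
  have h1 : ∀ a y, Commute (f (FreeGroup.of a)) (g y) := by
    intro a y
    induction y using FreeGroup.induction_on with
    | C1 => simp
    | of b => exact h a b
    | inv_of b ih => rw [map_inv]; exact ih.inv_right
    | mul x y hx hy => rw [map_mul]; exact hx.mul_right hy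
  induction x using FreeGroup.induction_on with
  | C1 => simp
  | of b => exact h1 b y
  | inv_of b ih => rw [map_inv]; exact ih.inv_left
  | mul x y hx hy => rw [map_mul]; exact hx.mul_left hy

theorem pres_double {A : Type} [Group A] {k L : ℕ} (hS : SPC A) (hP : commutator A = ⊤)
    (h : HasPresentationCard A k L) (θ : FreeGroup (Fin k) →* A × A)
    (hθ : Function.Surjective θ) : HasPresentationCard (A × A) k (L + (k ^ 2 + 2 * k)) := by
  obtain ⟨φ, hφ, R, hR, hRc, hk⟩ := h
  have hφR : ∀ x ∈ R, φ x = 1 := fun x hx => by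
    have : x ∈ φ.ker := hk ▸ Subgroup.subset_normalClosure hx
    exact this
  -- words in the commutator subgroup representing the generators
  have hw : ∀ i : Fin k, ∃ w ∈ commutator (FreeGroup (Fin k)), φ w = φ (FreeGroup.of i) := by
    intro i
    have : (commutator (FreeGroup (Fin k))).map φ = ⊤ := by
      rw [commutator_def, Subgroup.map_commutator, Subgroup.map_top_of_surjective φ hφ,
        ← commutator_def, hP]
    have h2 : φ (FreeGroup.of i) ∈ (commutator (FreeGroup (Fin k))).map φ := by
      rw [this]; trivial
    exact h2
  choose w hwc hwφ using hw
  let i₁ : FreeGroup (Fin k) →* FreeGroup (Fin k ⊕ Fin k) :=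
    FreeGroup.lift fun i => FreeGroup.of (Sum.inl i)
  let i₂ : FreeGroup (Fin k) →* FreeGroup (Fin k ⊕ Fin k) :=
    FreeGroup.lift fun i => FreeGroup.of (Sum.inr i)
  let δ : FreeGroup (Fin k) →* FreeGroup (Fin k ⊕ Fin k) :=
    FreeGroup.lift fun i => FreeGroup.of (Sum.inl i) * FreeGroup.of (Sum.inr i)
  let ψ : FreeGroup (Fin k ⊕ Fin k) →* A × A :=
    FreeGroup.lift (Sum.elim (fun i => (φ (FreeGroup.of i), 1)) (fun i => (1, φ (FreeGroup.of i))))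
  have hψ₁ : ∀ x, ψ (i₁ x) = (φ x, 1) := by
    intro x
    have : ψ.comp i₁ = (MonoidHom.inl A A).comp φ := FreeGroup.ext_hom _ _ fun i => by
      simp [ψ, i₁]
    exact DFunLike.congr_fun this x
  have hψ₂ : ∀ x, ψ (i₂ x) = (1, φ x) := by
    intro x
    have : ψ.comp i₂ = (MonoidHom.inr A A).comp φ := FreeGroup.ext_hom _ _ fun i => by
      simp [ψ, i₂]
    exact DFunLike.congr_fun this x
  have hψδ : ∀ x, ψ (δ x) = (φ x, φ x) := by
    intro x
    have : ψ.comp δ = φ.prod φ := FreeGroup.ext_hom _ _ fun i => by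
      simp [ψ, δ]
    exact DFunLike.congr_fun this x
  have hψs : Function.Surjective ψ := by
    rintro ⟨a, b⟩
    obtain ⟨x, rfl⟩ := hφ a
    obtain ⟨y, rfl⟩ := hφ b
    exact ⟨i₁ x * i₂ y, by rw [map_mul, hψ₁, hψ₂]; simp⟩
  let c : Fin k × Fin k → FreeGroup (Fin k ⊕ Fin k) := fun p =>
    ⁅i₁ (FreeGroup.of p.1), i₂ (FreeGroup.of p.2)⁆
  let d : Fin k → FreeGroup (Fin k ⊕ Fin k) := fun i => i₁ ((FreeGroup.of i)⁻¹ * w i)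
  let T : Set (FreeGroup (Fin k ⊕ Fin k)) := δ '' R ∪ (Set.range c ∪ Set.range d)
  have hTf : T.Finite := (hR.image _).union ((Set.finite_range _).union (Set.finite_range _))
  have hTc : T.ncard ≤ L + (k ^ 2 + k) := by
    refine (Set.ncard_union_le _ _).trans (add_le_add ((Set.ncard_image_le hR).trans hRc) ?_)
    refine (Set.ncard_union_le _ _).trans (add_le_add ?_ ?_)
    · have := ncard_range_fin c
      simpa [sq] using this
    · simpa using ncard_range_fin d
  have hTψ : Subgroup.normalClosure T ≤ ψ.ker := by
    apply Subgroup.normalClosure_le_normal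
    rintro x (⟨y, hy, rfl⟩ | ⟨p, rfl⟩ | ⟨i, rfl⟩)
    · simp only [SetLike.mem_coe, MonoidHom.mem_ker]
      rw [hψδ, hφR y hy]; rfl
    · simp only [SetLike.mem_coe, MonoidHom.mem_ker, c]
      rw [map_commutatorElement, hψ₁, hψ₂, commutatorElement_eq_one_iff_mul_comm]
      simp
    · simp only [SetLike.mem_coe, MonoidHom.mem_ker, d]
      rw [hψ₁, map_mul, map_inv, hwφ, inv_mul_cancel]; rfl
  have hker : ψ.ker = Subgroup.normalClosure T := by
    refine le_antisymm ?_ hTψ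
    let M := Subgroup.normalClosure T
    let π := QuotientGroup.mk' M
    have hπ : ∀ x, π x = 1 ↔ x ∈ M := fun x => QuotientGroup.eq_one_iff (N := M) x
    have hπT : ∀ x ∈ T, π x = 1 := fun x hx => (hπ x).2 (Subgroup.subset_normalClosure hx)
    let j₁ := π.comp i₁
    let j₂ := π.comp i₂
    have hcomm : ∀ x y, Commute (j₁ x) (j₂ y) := by
      apply free_commute
      intro a b
      rw [← commutatorElement_eq_one_iff_commute]
      have := hπT (c (a, b)) (Or.inr (Or.inl ⟨_, rfl⟩))
      simp only [c, map_commutatorElement] at this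
      exact this
    have hδ : ∀ x, π (δ x) = j₁ x * j₂ x := by
      intro x
      induction x using FreeGroup.induction_on with
      | C1 => simp
      | of b => simp [δ, j₁, j₂, i₁, i₂]
      | inv_of b ih => rw [map_inv, map_inv, ih, map_inv, map_inv, mul_inv_rev,
          ((hcomm (FreeGroup.of b) (FreeGroup.of b)).inv_inv).eq]
      | mul x y hx hy =>
        rw [map_mul, map_mul, hx, hy, map_mul, map_mul]
        exact (hcomm y x).symm.mul_mul_mul_comm _ _
    have hK : ∀ x ∈ φ.ker, j₁ x * j₂ x = 1 := by
      intro x hx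
      have : φ.ker ≤ (π.comp δ).ker := by
        rw [hk]
        apply Subgroup.normalClosure_le_normal
        intro y hy
        exact hπT _ (Or.inl ⟨y, hy, rfl⟩)
      rw [← hδ]
      exact this hx
    have hFK : ⁅(⊤ : Subgroup (FreeGroup (Fin k))), φ.ker⁆ ≤ j₁.ker := by
      rw [Subgroup.commutator_le]
      intro f _ x hx
      rw [MonoidHom.mem_ker, map_commutatorElement, commutatorElement_eq_one_iff_commute,
        eq_inv_of_mul_eq_one_left (hK x hx)]
      exact (hcomm f x).inv_right
    have hd : ∀ i, (FreeGroup.of i)⁻¹ * w i ∈ φ.ker ⊓ j₁.ker := by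
      intro i
      refine ⟨?_, hπT _ (Or.inr (Or.inr ⟨i, rfl⟩))⟩
      change φ _ = 1
      rw [map_mul, map_inv, hwφ, inv_mul_cancel]
    have htop : commutator (FreeGroup (Fin k)) ⊔ (φ.ker ⊓ j₁.ker) = ⊤ := by
      rw [eq_top_iff, ← FreeGroup.closure_range_of, Subgroup.closure_le]
      rintro _ ⟨i, rfl⟩
      have := mul_mem (Subgroup.mem_sup_left (hwc i) :
        w i ∈ commutator (FreeGroup (Fin k)) ⊔ (φ.ker ⊓ j₁.ker))
        (Subgroup.mem_sup_right (inv_mem (hd i)))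
      simpa [mul_assoc] using this
    have hj₁ : ∀ x, φ x = 1 → j₁ x = 1 := by
      intro x hx
      have hx' : x ∈ commutator (FreeGroup (Fin k)) ⊔ (φ.ker ⊓ j₁.ker) := by rw [htop]; trivial
      obtain ⟨u, hu, v, ⟨hv1, hv2⟩, rfl⟩ := Subgroup.mem_sup_of_normal_left.1 hx'
      have hv1 : φ v = 1 := hv1
      have hv2 : j₁ v = 1 := hv2
      rw [map_mul, hv1, mul_one] at hx
      rw [map_mul, hv2, mul_one]
      exact hFK (hS.hopf φ hφ u hu hx)
    have hj₂ : ∀ x, φ x = 1 → j₂ x = 1 := by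
      intro x hx
      have := hK x hx
      rwa [hj₁ x hx, one_mul] at this
    have hdec : ∀ z, ∃ x y, π z = j₁ x * j₂ y := by
      intro z
      induction z using FreeGroup.induction_on with
      | C1 => exact ⟨1, 1, by simp⟩
      | of b =>
        rcases b with b | b
        · exact ⟨FreeGroup.of b, 1, by simp [j₁, i₁]⟩
        · exact ⟨1, FreeGroup.of b, by simp [j₂, i₂]⟩
      | inv_of b ih =>
        obtain ⟨x, y, hxy⟩ := ih
        refine ⟨x⁻¹, y⁻¹, ?_⟩
        rw [map_inv, hxy, map_inv, map_inv, mul_inv_rev, ((hcomm x y).inv_inv).eq]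
      | mul z z' hz hz' =>
        obtain ⟨x, y, hxy⟩ := hz
        obtain ⟨x', y', hxy'⟩ := hz'
        refine ⟨x * x', y * y', ?_⟩
        rw [map_mul, hxy, hxy', map_mul, map_mul]
        exact (hcomm x' y).symm.mul_mul_mul_comm _ _
    intro z hz
    have hz : ψ z = 1 := hz
    obtain ⟨x, y, hxy⟩ := hdec z
    have h1 : (i₁ x * i₂ y)⁻¹ * z ∈ M := by
      rw [← hπ, map_mul, map_inv, hxy, map_mul]
      exact inv_mul_cancel _
    have h2 : ψ ((i₁ x * i₂ y)⁻¹ * z) = 1 := hTψ h1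
    rw [map_mul, map_inv, hz, mul_one, inv_eq_one, map_mul, hψ₁, hψ₂] at h2
    have hx1 : φ x = 1 := by simpa using congrArg Prod.fst h2
    have hy1 : φ y = 1 := by simpa using congrArg Prod.snd h2
    rw [← hπ, hxy, hj₁ x hx1, hj₂ y hy1, mul_one]
  refine (change_gens ψ hψs T hTf hTc hker θ hθ).mono ?_
  omega

end Helpers

/-- `G^(a+b) ≃ G^a × G^b`. -/
def splitEquiv (G : Type*) [Group G] (a b : ℕ) : (Fin a → G) × (Fin b → G) ≃* (Fin (a + b) → G) :=
  MulEquiv.symm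
  { toFun := fun f => (fun i => f (Fin.castAdd b i), fun i => f (Fin.natAdd a i))
    invFun := fun p => Fin.append p.1 p.2
    left_inv := fun f => Fin.append_castAdd_natAdd
    right_inv := fun p => by ext <;> simp
    map_mul' := fun _ _ => rfl }

theorem perfect_prod {A B : Type*} [Group A] [Group B] (hA : commutator A = ⊤)
    (hB : commutator B = ⊤) : commutator (A × B) = ⊤ := by
  rw [commutator_def, ← Subgroup.top_prod_top, Subgroup.commutator_prod_prod,
    ← commutator_def, ← commutator_def, hA, hB]

theorem perfect_congr {A B : Type*} [Group A] [Group B] (e : A ≃* B) (hA : commutator A = ⊤) :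
    commutator B = ⊤ := by
  have h := Subgroup.map_commutator (⊤ : Subgroup A) ⊤ e.toMonoidHom
  rw [← commutator_def, hA, Subgroup.map_top_of_surjective _ e.surjective] at h
  rw [commutator_def, ← h]

theorem gens_of_dGen {Γ : Type*} [Group Γ] [hfg : Group.FG Γ] {k : ℕ} (h : dGen Γ ≤ k) :
    ∃ θ : FreeGroup (Fin k) →* Γ, Function.Surjective θ := by
  have hne : {d | ∃ S : Set Γ, S.Finite ∧ S.ncard = d ∧ Subgroup.closure S = ⊤}.Nonempty := by
    obtain ⟨S, h1, h2⟩ := Group.fg_iff.1 hfg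
    exact ⟨_, S, h2, rfl, h1⟩
  obtain ⟨S, hS, hc, hcl⟩ := Nat.sInf_mem hne
  have hSk : S.ncard ≤ k := by rw [hc]; exact h
  have : Finite S := hS
  obtain ⟨e⟩ : Nonempty (S ≃ Fin S.ncard) := ⟨Finite.equivFin S⟩
  refine ⟨FreeGroup.lift fun i => if hi : (i : ℕ) < S.ncard then (e.symm ⟨i, hi⟩ : Γ) else 1, ?_⟩
  rw [FreeGroup.lift_surjective_iff_closure_range_eq_top, eq_top_iff, ← hcl]
  apply Subgroup.closure_mono
  intro s hs
  refine ⟨⟨e ⟨s, hs⟩, (e ⟨s, hs⟩).2.trans_le hSk⟩, ?_⟩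
  simp

/-- Corollary 2.5: if `G = ⟨x₁,…,x_k ∣ r₁,…,r_l⟩` with `H₁(G,ℤ) = H₂(G,ℤ) = 0`,
`d(G^N) ≤ k` and `1 ≤ m ≤ N/2`, then `G^m` has a presentation with `k`
generators and at most `n(k² + 2k) + l + k` relators, where `n = ⌈log₂ m⌉`
(i.e. `Nat.clog 2 m`) is the least integer with `m ≤ 2ⁿ`. -/
theorem stmt_9 {k l : ℕ} (r : Fin l → FreeGroup (Fin k))
    (hH1 : Subsingleton (Abelianization (PresentedGroup (Set.range r))))
    (hH2 : Subsingleton (H2 (PresentedGroup (Set.range r))))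
    {N : ℕ} (hN : dGen (Fin N → PresentedGroup (Set.range r)) ≤ k)
    (m : ℕ) (hm : 1 ≤ m) (hmN : 2 * m ≤ N) :
    HasPresentationCard (Fin m → PresentedGroup (Set.range r)) k
      (Nat.clog 2 m * (k ^ 2 + 2 * k) + l + k) := by
  classical
  set G := PresentedGroup (Set.range r) with hG
  have hP : commutator G = ⊤ := by
    rw [eq_top_iff]
    intro x _
    exact (QuotientGroup.eq_one_iff (N := commutator G) x).1 (hH1.elim _ _)
  have hS : SPC G := SPC.of_H2 hH2
  have hpres : HasPresentationCard G k l := by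
    refine ⟨PresentedGroup.mk (Set.range r), PresentedGroup.mk_surjective _, Set.range r,
      Set.finite_range _, ?_, QuotientGroup.ker_mk' _⟩
    simpa using ncard_range_fin r
  have hfg : Group.FG G := Group.fg_of_surjective (PresentedGroup.mk_surjective (Set.range r))
  obtain ⟨θ, hθ⟩ := gens_of_dGen hN
  have hgen : ∀ b ≤ N, ∃ θ : FreeGroup (Fin k) →* (Fin b → G), Function.Surjective θ := by
    intro b hb
    obtain ⟨c, rfl⟩ := Nat.exists_eq_add_of_le hb
    exact ⟨((MonoidHom.fst _ _).comp (splitEquiv G b c).symm.toMonoidHom).comp θ,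
      (Prod.fst_surjective.comp (splitEquiv G b c).symm.surjective).comp hθ⟩
  have main : ∀ n : ℕ, 2 ^ n ≤ N → SPC (Fin (2 ^ n) → G) ∧ commutator (Fin (2 ^ n) → G) = ⊤ ∧
      HasPresentationCard (Fin (2 ^ n) → G) k (n * (k ^ 2 + 2 * k) + l) := by
    intro n
    induction n with
    | zero =>
      intro _
      let e : G ≃* (Fin (2 ^ 0) → G) := (MulEquiv.funUnique (Fin 1) G).symm
      exact ⟨hS.congr e, perfect_congr e hP, (hpres.congr e).mono (by simp)⟩
    | succ n ih =>
      intro hn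
      have h2 : 2 ^ (n + 1) = 2 ^ n + 2 ^ n := by ring
      rw [h2] at hn ⊢
      obtain ⟨a, b, c⟩ := ih (by omega)
      let e := splitEquiv G (2 ^ n) (2 ^ n)
      obtain ⟨θ', hθ'⟩ := hgen _ hn
      refine ⟨(a.prod a b).congr e, perfect_congr e (perfect_prod b b), ?_⟩
      have := (pres_double a b c (e.symm.toMonoidHom.comp θ') (e.symm.surjective.comp hθ')).congr e
      refine this.mono (le_of_eq ?_)
      ring
  have hle : m ≤ 2 ^ Nat.clog 2 m := Nat.le_pow_clog (by norm_num) m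
  have hlt : 2 ^ Nat.clog 2 m ≤ N := by
    rcases Nat.lt_or_ge 1 m with h1 | h1
    · have h3 := Nat.pow_pred_clog_lt_self (b := 2) (by norm_num) h1
      have h4 : 0 < Nat.clog 2 m := Nat.clog_pos (by norm_num) h1
      obtain ⟨q, hq⟩ := Nat.exists_eq_succ_of_ne_zero h4.ne'
      rw [hq] at h3 ⊢
      simp only [Nat.pred_succ, Nat.succ_eq_add_one, pow_succ] at h3 ⊢
      omega
    · have : m = 1 := by omega
      subst this
      simp
      omega
  obtain ⟨-, -, h⟩ := main _ hlt
  obtain ⟨b, hb⟩ := Nat.exists_eq_add_of_le hle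
  rw [hb] at h hlt
  obtain ⟨θb, hθb⟩ := hgen b (by omega)
  exact pres_quot (h.congr (splitEquiv G m b).symm) θb hθb
end

section
/- Let G be a finitely presented group with H_1(G,ℤ) ≠ 0. Then for every n ≥ 1 the abelian group H_2(Gⁿ,ℤ) cannot be generated by fewer than n(n−1)/2 elements, and consequently every finite presentation of Gⁿ has at least n(n−1)/2 relators, i.e., ρ(Gⁿ) ≥ n(n−1)/2. -/
namespace Stmt16

open scoped commutatorElement

/-- Index set of pairs `i < j` in `Fin n`. -/
abbrev Pairs (n : ℕ) : Type := Σ j : Fin n, Fin j.val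

/-- The smaller index of a pair. -/
def Pairs.lo {n : ℕ} (p : Pairs n) : Fin n := Fin.castLE p.1.isLt.le p.2

theorem card_pairs (n : ℕ) : Fintype.card (Pairs n) = n * (n - 1) / 2 := by
  rw [Fintype.card_sigma]
  simp only [Fintype.card_fin]
  rw [Fin.sum_univ_eq_sum_range (fun i => i) n, Finset.sum_range_id]

/-- A Heisenberg-type central extension of `K^n` by `K^(pairs)`. -/
@[ext]
structure Heis (K : Type) (n : ℕ) where
  v : Fin n → K
  w : Pairs n → K

variable {K : Type} [Field K] {n : ℕ}

/-- The cocycle. -/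
def bil (x y : Fin n → K) : Pairs n → K := fun p => x p.lo * y p.1

instance : Mul (Heis K n) := ⟨fun x y => ⟨x.v + y.v, x.w + y.w + bil x.v y.v⟩⟩
instance : One (Heis K n) := ⟨⟨0, 0⟩⟩
instance : Inv (Heis K n) := ⟨fun x => ⟨-x.v, -x.w + bil x.v x.v⟩⟩

@[simp] theorem mul_v (x y : Heis K n) : (x * y).v = x.v + y.v := rfl
@[simp] theorem mul_w (x y : Heis K n) : (x * y).w = x.w + y.w + bil x.v y.v := rfl
@[simp] theorem one_v : (1 : Heis K n).v = 0 := rfl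
@[simp] theorem one_w : (1 : Heis K n).w = 0 := rfl
@[simp] theorem inv_v (x : Heis K n) : (x⁻¹).v = -x.v := rfl
@[simp] theorem inv_w (x : Heis K n) : (x⁻¹).w = -x.w + bil x.v x.v := rfl

instance : Group (Heis K n) :=
  Group.ofLeftAxioms
    (fun a b c => by
      ext p
      · simp [add_assoc]
      · simp [bil]; ring)
    (fun a => by ext p <;> simp [bil])
    (fun a => by ext p <;> simp [bil])

theorem comm_w (x y : Heis K n) : (⁅x, y⁆).w = bil x.v y.v - bil y.v x.v := by
  ext p
  simp [commutatorElement_def, bil]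
  ring

theorem comm_v (x y : Heis K n) : (⁅x, y⁆).v = 0 := by
  ext p
  simp [commutatorElement_def]

/-- Central subgroup attached to a subspace. -/
def cen (U : Submodule K (Pairs n → K)) : Subgroup (Heis K n) where
  carrier := {x | x.v = 0 ∧ x.w ∈ U}
  one_mem' := ⟨rfl, U.zero_mem⟩
  mul_mem' := by
    rintro x y ⟨hx, hx'⟩ ⟨hy, hy'⟩
    refine ⟨by simp [hx, hy], ?_⟩
    have : bil x.v y.v = 0 := by ext p; simp [bil, hx]
    simp only [mul_w, this, add_zero]
    exact U.add_mem hx' hy'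
  inv_mem' := by
    rintro x ⟨hx, hx'⟩
    refine ⟨by simp [hx], ?_⟩
    have : bil x.v x.v = 0 := by ext p; simp [bil, hx]
    simp only [inv_w, this, add_zero]
    exact U.neg_mem hx'

theorem central_of_v (x y : Heis K n) (hx : x.v = 0) : y * x = x * y := by
  ext p
  · simp [add_comm]
  · simp [bil, hx, add_comm]

instance (U : Submodule K (Pairs n → K)) : (cen U).Normal where
  conj_mem x hx g := by
    rw [central_of_v x g hx.1, mul_inv_cancel_right]; exact hx

/-- If a finite set of vectors spans a subspace containing the standard basis, it is large. -/
theorem card_le_of_span (S : Set (Pairs n → K)) (hS : S.Finite)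
    (h : ∀ p, Pi.single p 1 ∈ Submodule.span K S) : n * (n - 1) / 2 ≤ S.ncard := by
  have htop : Submodule.span K S = ⊤ := by
    rw [eq_top_iff, ← (Pi.basisFun K (Pairs n)).span_eq, Submodule.span_le]
    rintro _ ⟨p, rfl⟩
    simpa using h p
  have := hS.fintype
  have h1 := finrank_span_le_card (R := K) S
  rw [htop, finrank_top, Module.finrank_fintype_fun_eq_card, card_pairs] at h1
  rwa [Set.ncard_eq_toFinset_card']

section Lifted
variable {X : Type*} {G : Type*} [Group G] (φ : FreeGroup X →* (Fin n → G))
  (a : G →* Multiplicative K)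

/-- Lift of a free group to the Heisenberg group. -/
def theta : FreeGroup X →* Heis K n :=
  FreeGroup.lift fun x => ⟨fun i => (a (φ (FreeGroup.of x) i)).toAdd, 0⟩

/-- Projection of the Heisenberg group. -/
def projV (i : Fin n) : Heis K n →* Multiplicative K where
  toFun x := Multiplicative.ofAdd (x.v i)
  map_one' := rfl
  map_mul' _ _ := rfl

theorem theta_v (f : FreeGroup X) (i : Fin n) : (theta φ a f).v i = (a (φ f i)).toAdd := by
  have : (projV i).comp (theta φ a) = (a.comp (Pi.evalMonoidHom (fun _ => G) i)).comp φ := by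
    ext x
    simp [theta, projV]
  exact congrArg Multiplicative.toAdd (DFunLike.congr_fun this f)

theorem theta_v_ker {f : FreeGroup X} (hf : f ∈ φ.ker) : (theta φ a f).v = 0 := by
  ext i
  rw [theta_v, MonoidHom.mem_ker.1 hf]; simp

theorem exists_single (hφ : Function.Surjective φ) (g : G) (hg : a g = Multiplicative.ofAdd 1)
    (p : Pairs n) : ∃ r ∈ φ.ker ⊓ commutator (FreeGroup X), (theta φ a r).w = Pi.single p 1 := by
  obtain ⟨x, hx⟩ := hφ (Pi.mulSingle p.lo g)
  obtain ⟨y, hy⟩ := hφ (Pi.mulSingle p.1 g)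
  have hlt : p.lo < p.1 := p.2.isLt
  refine ⟨⁅x, y⁆, ⟨?_, ?_⟩, ?_⟩
  · change φ ⁅x, y⁆ = 1
    rw [map_commutatorElement, hx, hy, commutatorElement_eq_one_iff_commute]
    exact Pi.mulSingle_commute (f := fun _ : Fin n => G) hlt.ne g g
  · exact Subgroup.commutator_mem_commutator (Subgroup.mem_top _) (Subgroup.mem_top _)
  · have vx : (theta φ a x).v = Pi.single p.lo 1 := by
      ext i
      rw [theta_v, hx]
      by_cases h : i = p.lo
      · subst h; simp [hg]
      · simp [h]
    have vy : (theta φ a y).v = Pi.single p.1 1 := by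
      ext i
      rw [theta_v, hy]
      by_cases h : i = p.1
      · subst h; simp [hg]
      · simp [h]
    rw [map_commutatorElement, comm_w, vx, vy]
    ext q
    have hqlt : q.lo < q.1 := q.2.isLt
    by_cases hq : q = p
    · subst hq
      simp [bil, hlt.ne]
    · have h1 : ¬ (q.lo = p.lo ∧ q.1 = p.1) := by
        rintro ⟨h1, h2⟩
        apply hq
        obtain ⟨qj, qi⟩ := q
        obtain ⟨pj, pi⟩ := p
        simp only at h2
        subst h2
        congr 1
        simpa [Pairs.lo] using h1
      have h2 : ¬ (q.lo = p.1 ∧ q.1 = p.lo) := by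
        rintro ⟨h1, h2⟩
        rw [h1, h2] at hqlt
        exact absurd hlt hqlt.not_gt
      simp only [bil, Pi.sub_apply, Pi.single_apply, hq]
      by_cases ha : q.lo = p.lo <;> by_cases hb : q.1 = p.1 <;> by_cases hc : q.lo = p.1 <;>
        by_cases hd : q.1 = p.lo <;> simp_all

theorem pres_bound (hφ : Function.Surjective φ) (g : G) (hg : a g = Multiplicative.ofAdd 1)
    (R : Set (FreeGroup X)) (hR : R.Finite) (hker : φ.ker = Subgroup.normalClosure R) :
    n * (n - 1) / 2 ≤ R.ncard := by
  let f : FreeGroup X → (Pairs n → K) := fun r => (theta φ a r).w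
  refine (card_le_of_span (f '' R) (hR.image f) ?_).trans (Set.ncard_image_le hR)
  intro p
  obtain ⟨r, hr, hrw⟩ := exists_single φ a hφ g hg p
  have hle : Subgroup.normalClosure R ≤
      (cen (Submodule.span K (f '' R))).comap (theta φ a) := by
    apply Subgroup.normalClosure_le_normal
    intro r hr
    exact ⟨theta_v_ker φ a (hker ▸ Subgroup.subset_normalClosure hr),
      Submodule.subset_span ⟨r, hr, rfl⟩⟩
  have := hle (hker ▸ hr.1)
  rw [← hrw]
  exact this.2

theorem H2_bound (hφ : Function.Surjective φ) (g : G) (hg : a g = Multiplicative.ofAdd 1)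
    (T : Set (↥(φ.ker ⊓ commutator (FreeGroup X)) ⧸
      (⁅(⊤ : Subgroup (FreeGroup X)), φ.ker⁆.subgroupOf (φ.ker ⊓ commutator (FreeGroup X)))))
    (hT : T.Finite) (hcl : Subgroup.closure T = ⊤) :
    n * (n - 1) / 2 ≤ T.ncard := by
  let Θ : (↥(φ.ker ⊓ commutator (FreeGroup X)) ⧸
      (⁅(⊤ : Subgroup (FreeGroup X)), φ.ker⁆.subgroupOf (φ.ker ⊓ commutator (FreeGroup X))))
      →* Heis K n := QuotientGroup.lift _
      ((theta φ a).comp (Subgroup.subtype _)) (by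
        intro x hx
        have hle : ⁅(⊤ : Subgroup (FreeGroup X)), φ.ker⁆ ≤ (theta φ a).ker := by
          rw [Subgroup.commutator_le]
          intro y _ z hz
          rw [MonoidHom.mem_ker, map_commutatorElement, commutatorElement_eq_one_iff_mul_comm]
          exact central_of_v _ _ (theta_v_ker φ a hz)
        exact hle hx)
  have hΘv : ∀ t, (Θ t).v = 0 := by
    intro t
    obtain ⟨x, rfl⟩ := QuotientGroup.mk_surjective t
    exact theta_v_ker φ a x.2.1
  let f := fun t => (Θ t).w
  refine (card_le_of_span (f '' T) (hT.image f) ?_).trans (Set.ncard_image_le hT)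
  intro p
  obtain ⟨r, hr, hrw⟩ := exists_single φ a hφ g hg p
  have hle : Subgroup.closure T ≤ (cen (Submodule.span K (f '' T))).comap Θ := by
    rw [Subgroup.closure_le]
    intro t ht
    exact ⟨hΘv t, Submodule.subset_span ⟨t, ht, rfl⟩⟩
  have := (hcl ▸ hle) (Subgroup.mem_top (QuotientGroup.mk
    (⟨r, hr⟩ : ↥(φ.ker ⊓ commutator (FreeGroup X)))))
  rw [← hrw]
  exact this.2

end Lifted

theorem exists_char (G : Type*) [Group G] [Group.FG G] (hH1 : Nontrivial (Abelianization G)) :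
    ∃ (K : Type) (_ : Field K) (a : G →* Multiplicative K) (g : G),
      a g = Multiplicative.ofAdd 1 := by
  let A := Additive (Abelianization G)
  have hfg : Group.FG (Abelianization G) :=
    Group.fg_of_surjective (f := Abelianization.of) (QuotientGroup.mk_surjective)
  have : Module.Finite ℤ A := by
    rw [Module.Finite.iff_addGroup_fg]
    infer_instance
  have : Nontrivial A := inferInstanceAs (Nontrivial (Abelianization G))
  obtain ⟨m, hm, -⟩ := (eq_top_or_exists_le_coatom (⊥ : Submodule ℤ A)).resolve_left bot_ne_top
  have hs : IsSimpleModule ℤ (A ⧸ m) := isSimpleModule_iff_isCoatom.2 hm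
  obtain ⟨I, hI, ⟨e⟩⟩ := isSimpleModule_iff_quot_maximal.1 hs
  let _ : Field (ℤ ⧸ I) := Ideal.Quotient.field I
  let b : A →+ (ℤ ⧸ I) := (e.toLinearMap.comp m.mkQ).toAddMonoidHom
  have hb : Function.Surjective b := e.surjective.comp (Submodule.mkQ_surjective m)
  obtain ⟨x, hx⟩ := hb 1
  obtain ⟨g, hg⟩ := (QuotientGroup.mk_surjective) x.toMul
  refine ⟨ℤ ⧸ I, inferInstance, (AddMonoidHom.toMultiplicativeRight b).comp Abelianization.of,
    g, ?_⟩
  have : Additive.ofMul (Abelianization.of g) = x := congrArg Additive.ofMul hg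
  rw [← hx, ← this]
  rfl

open Monoid in
theorem fp_prod (G H : Type*) [Group G] [Group H] [Group.FG G] [Group.FG H]
    [Group.IsFinitelyPresented G] [Group.IsFinitelyPresented H] :
    Group.IsFinitelyPresented (G × H) := by
  obtain ⟨S, hS, hSf⟩ := Group.fg_iff.1 ‹Group.FG G›
  obtain ⟨T, hT, hTf⟩ := Group.fg_iff.1 ‹Group.FG H›
  refine Group.IsFinitelyPresented.of_surjective (Coprod.toProd (M := G) (N := H))
    Coprod.toProd_surjective
    ⟨Set.image2 (fun (s : G) (t : H) => ⁅(Coprod.inl s : Coprod G H), (Coprod.inr t : Coprod G H)⁆) S T,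
      hSf.image2 _ hTf, ?_⟩
  set N := Subgroup.normalClosure
    (Set.image2 (fun (s : G) (t : H) => ⁅(Coprod.inl s : Coprod G H), (Coprod.inr t : Coprod G H)⁆) S T) with hN
  apply le_antisymm
  · apply Subgroup.normalClosure_le_normal
    rintro _ ⟨s, -, t, -, rfl⟩
    simp [MonoidHom.mem_ker, map_commutatorElement, commutatorElement_def]
  · let q := QuotientGroup.mk' N
    have h0 : ∀ s ∈ S, ∀ t ∈ T, Commute (q (Coprod.inl s)) (q (Coprod.inr t)) := by
      intro s hs t ht
      rw [← commutatorElement_eq_one_iff_commute, ← map_commutatorElement, ← MonoidHom.mem_ker,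
        QuotientGroup.ker_mk']
      exact Subgroup.subset_normalClosure ⟨s, hs, t, ht, rfl⟩
    have h1 : ∀ s ∈ S, ∀ t, Commute (q (Coprod.inl s)) (q (Coprod.inr t)) := by
      intro s hs t
      have ht : t ∈ Subgroup.closure T := hT ▸ Subgroup.mem_top t
      induction ht using Subgroup.closure_induction with
      | mem t ht => exact h0 s hs t ht
      | one => simp
      | mul x y _ _ hx hy => simpa using hx.mul_right hy
      | inv x _ hx => simpa using hx.inv_right
    have h2 : ∀ s t, Commute (q (Coprod.inl s)) (q (Coprod.inr t)) := by
      intro s t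
      have hs : s ∈ Subgroup.closure S := hS ▸ Subgroup.mem_top s
      induction hs using Subgroup.closure_induction with
      | mem s hs => exact h1 s hs t
      | one => simp
      | mul x y _ _ hx hy => simpa using hx.mul_left hy
      | inv x _ hx => simpa using hx.inv_left
    let d : G × H →* (Coprod G H ⧸ N) :=
      (q.comp Coprod.inl).noncommCoprod (q.comp Coprod.inr) h2
    have hd : d.comp Coprod.toProd = q := by
      ext x <;> simp [d]
    intro x hx
    rw [← QuotientGroup.ker_mk' N, MonoidHom.mem_ker]
    change q x = 1
    rw [← hd, MonoidHom.comp_apply, MonoidHom.mem_ker.1 hx, map_one]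

theorem fg_of_fp (G : Type*) [Group G] [h : Group.IsFinitelyPresented G] : Group.FG G := by
  obtain ⟨n, φ, hφ, -⟩ := h
  exact Group.fg_of_surjective hφ

theorem fp_pi (G : Type*) [Group G] [Group.IsFinitelyPresented G] (n : ℕ) :
    Group.IsFinitelyPresented (Fin n → G) := by
  induction n with
  | zero => infer_instance
  | succ n ih =>
    have := fg_of_fp G
    have := fg_of_fp (Fin n → G)
    have := fp_prod G (Fin n → G)
    exact Group.IsFinitelyPresented.equiv (G := G × (Fin n → G))
      { Fin.consEquiv (fun _ : Fin (n + 1) => G) with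
        map_mul' := by
          rintro ⟨x, y⟩ ⟨z, w⟩
          ext i
          refine Fin.cases ?_ (fun i => ?_) i <;> simp [Fin.consEquiv] }

theorem fp_iff (G : Type*) [Group G] : FinitelyPresented G ↔ Group.IsFinitelyPresented G := by
  constructor
  · rintro ⟨k, l, φ, hφ, R, hR, -, h⟩
    exact ⟨k, φ, hφ, R, hR, h.symm⟩
  · rintro ⟨k, φ, hφ, R, hR, h⟩
    exact ⟨k, R.ncard, φ, hφ, R, hR, le_rfl, h.symm⟩

end Stmt16

/-- If `G` is finitely presented with `H₁(G,ℤ) ≠ 0`, then `H₂(Gⁿ,ℤ)` cannot be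
generated by fewer than `n(n-1)/2` elements, and consequently every finite
presentation of `Gⁿ` has at least `n(n-1)/2` relators, i.e.
`ρ(Gⁿ) ≥ n(n-1)/2`. -/
theorem stmt_16 (G : Type*) [Group G] (hFP : FinitelyPresented G)
    (hH1 : Nontrivial (Abelianization G)) (n : ℕ) (hn : 1 ≤ n) :
    (∀ T : Set (H2 (Fin n → G)), T.Finite → Subgroup.closure T = ⊤ →
      n * (n - 1) / 2 ≤ T.ncard) ∧
    (∀ k l : ℕ, HasPresentationCard (Fin n → G) k l → n * (n - 1) / 2 ≤ l) ∧
    n * (n - 1) / 2 ≤ rho (Fin n → G) := by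
  have hfp := (Stmt16.fp_iff G).1 hFP
  have := Stmt16.fg_of_fp G
  obtain ⟨K, _, a, g, hg⟩ := Stmt16.exists_char G hH1
  have key : ∀ k l : ℕ, HasPresentationCard (Fin n → G) k l → n * (n - 1) / 2 ≤ l := by
    rintro k l ⟨φ, hφ, R, hR, hRl, hker⟩
    exact (Stmt16.pres_bound φ a hφ g hg R hR hker).trans hRl
  refine ⟨?_, key, ?_⟩
  · intro T hT hcl
    exact Stmt16.H2_bound (FreeGroup.lift (id : (Fin n → G) → (Fin n → G))) a
      (fun x => ⟨FreeGroup.of x, by simp⟩) g hg T hT hcl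
  · obtain ⟨k, l, h⟩ := (Stmt16.fp_iff (Fin n → G)).2 (Stmt16.fp_pi G n)
    have hne : {l | ∃ k, HasPresentationCard (Fin n → G) k l}.Nonempty := ⟨l, k, h⟩
    obtain ⟨k', hk'⟩ := Nat.sInf_mem hne
    exact key k' _ hk'
end
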